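/- The multi-indexed Meixner-Pollaczek polynomials with D = {1} satisfy the 5-term recurrence X(η) P_{D,n}(η) = Σ_{k=-2}^{2} r_{n,k} P_{D,n+k}(η), where X(η) = η(sin φ · η + 2(1-a) cos φ), r_{n,2} = ((n+1)(n+2)/(4 sin φ))·(2a+n-2)/(2a+n), r_{n,-2} = (2a+n-2)(2a+n-1)/(4 sin φ), r_{n,1} = -(n+1)(2a+n-2) cot φ, r_{n,-1} = -(2a+n-2)(2a+n-1) cot φ, and r_{n,0} = (a(6a+10n-7)+3n²-7n+1)/(2 sin φ) - (1/4)(2a+2n-1)(6a+2n-5) sin φ. -/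

import Mathlib

open Finset

/-- Pochhammer symbol `(z)_n` in `ℂ`. -/
noncomputable def poch (z : ℂ) (n : ℕ) : ℂ := (ascPochhammer ℂ n).eval z

/-- The Meixner-Pollaczek polynomial
`P_n^{(a)}(x;φ) = ((2a)_n/n!) e^{inφ} · ₂F₁(-n, a+ix; 2a; 1-e^{-2iφ})`. -/
noncomputable def MP (a φ : ℝ) (n : ℕ) (x : ℂ) : ℂ :=
  poch (2 * (a : ℂ)) n / (n.factorial : ℂ) * Complex.exp ((n : ℂ) * (φ : ℂ) * Complex.I) *
    ∑ k ∈ Finset.range (n + 1),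
      poch (-(n : ℂ)) k * poch ((a : ℂ) + Complex.I * x) k /
        (poch (2 * (a : ℂ)) k * (k.factorial : ℂ)) *
        (1 - Complex.exp (-(2 * (φ : ℂ) * Complex.I))) ^ k


/-- The `D = {1}` multi-indexed Meixner-Pollaczek polynomial, given by the 2×2 determinant
`P̌_{D,n}(x) = i·[ξ̌₁(x+i/2) r₂ P̌_n(x-i/2) − ξ̌₁(x-i/2) r₁ P̌_n(x+i/2)]` with
`ξ̌₁(x) = P̌₁(x; 1-a, φ)`, `r₁ = (a - 1/2 - ix)`, `r₂ = -(a - 1/2 + ix)`. -/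
noncomputable def PD1 (a φ : ℝ) (n : ℕ) (x : ℂ) : ℂ :=
  Complex.I *
    (MP (1 - a) φ 1 (x + Complex.I / 2) * (-((a : ℂ) - 1 / 2 + Complex.I * x)) *
        MP a φ n (x - Complex.I / 2)
      - MP (1 - a) φ 1 (x - Complex.I / 2) * ((a : ℂ) - 1 / 2 - Complex.I * x) *
        MP a φ n (x + Complex.I / 2))

lemma poch_zero (z : ℂ) : poch z 0 = 1 := by simp [poch]

lemma poch_succ (z : ℂ) (n : ℕ) : poch z (n + 1) = poch z n * (z + n) := by
  simp [poch, ascPochhammer_succ_right]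

lemma poch_succ_left (z : ℂ) (n : ℕ) : poch z (n + 1) = z * poch (z + 1) n := by
  simp [poch, ascPochhammer_succ_left, Polynomial.eval_comp]

lemma poch_add (z : ℂ) (k m : ℕ) : poch z (k + m) = poch z k * poch (z + k) m := by
  induction m with
  | zero => simp [poch_zero]
  | succ m ih => rw [← add_assoc, poch_succ, poch_succ, ih]; push_cast; ring

lemma poch_neg (k m : ℕ) :
    poch (-((k + m : ℕ) : ℂ)) k * (m.factorial : ℂ) = (-1) ^ k * ((k + m).factorial : ℂ) := by
  induction k generalizing m with
  | zero => simp [poch_zero]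
  | succ k ih =>
    have h := ih (m + 1)
    rw [poch_succ]
    have e : k + 1 + m = k + (m + 1) := by ring
    rw [e]
    rw [Nat.factorial_succ] at h
    push_cast at h ⊢
    rw [pow_succ]
    linear_combination (-1) * h

noncomputable def uu (q c : ℂ) (m : ℕ) : ℂ := poch c m / (m.factorial : ℂ) * q ^ m

noncomputable def SS (q d c b : ℂ) (n : ℕ) : ℂ :=
  ∑ k ∈ Finset.range (n + 1), uu q (c + k) (n - k) * uu d b k

lemma uu_zero (q c : ℂ) : uu q c 0 = 1 := by simp [uu, poch_zero]

lemma uu_one (q c : ℂ) : uu q c 1 = c * q := by simp [uu, poch_succ, poch_zero]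

lemma SS_zero (q d c b : ℂ) : SS q d c b 0 = 1 := by simp [SS, uu_zero]

lemma uu_step (q c : ℂ) (m : ℕ) : uu q c (m + 1) = uu q (c + 1) (m + 1) - q * uu q (c + 1) m := by
  unfold uu
  rw [poch_succ_left, poch_succ, Nat.factorial_succ]
  have h1 : (m.factorial : ℂ) ≠ 0 := by exact_mod_cast m.factorial_ne_zero
  have h2 : (m : ℂ) + 1 ≠ 0 := by exact_mod_cast m.succ_ne_zero
  push_cast
  field_simp
  ring

lemma uu_der (q c : ℂ) (m : ℕ) : ((m : ℂ) + 1) * uu q c (m + 1) = q * c * uu q (c + 1) m := by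
  unfold uu
  rw [poch_succ_left, Nat.factorial_succ]
  have h1 : (m.factorial : ℂ) ≠ 0 := by exact_mod_cast m.factorial_ne_zero
  have h2 : (m : ℂ) + 1 ≠ 0 := by exact_mod_cast m.succ_ne_zero
  push_cast
  field_simp
  ring

lemma SS_R1 (q d c b : ℂ) (n : ℕ) :
    SS q d c b (n + 1) = SS q d (c + 1) b (n + 1) - q * SS q d (c + 1) b n := by
  unfold SS
  rw [Finset.sum_range_succ _ (n + 1), Finset.sum_range_succ _ (n + 1), Finset.mul_sum]
  have : ∀ k ∈ Finset.range (n + 1), uu q (c + k) (n + 1 - k) * uu d b k =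
      uu q (c + 1 + k) (n + 1 - k) * uu d b k - q * (uu q (c + 1 + k) (n - k) * uu d b k) := by
    intro k hk
    have hk' : k ≤ n := by simpa [Nat.lt_succ_iff] using hk
    rw [Nat.sub_add_comm hk', uu_step]
    rw [show c + (k : ℂ) + 1 = c + 1 + k by ring]
    ring
  rw [Finset.sum_congr rfl this, Finset.sum_sub_distrib]
  simp [uu_zero]
  ring

lemma SS_R2 (q d c b : ℂ) (n : ℕ) :
    SS q d c (b + 1) (n + 1) - SS q d c b (n + 1) = d * SS q d (c + 1) (b + 1) n := by
  unfold SS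
  rw [← Finset.sum_sub_distrib, Finset.sum_range_succ', Finset.mul_sum]
  simp only [uu_zero, sub_self, add_zero]
  refine Finset.sum_congr rfl fun k _ => ?_
  rw [uu_step d b k, Nat.add_sub_add_right]
  push_cast
  rw [show c + ((k : ℂ) + 1) = c + 1 + k by ring]
  ring

noncomputable def TT (q d c b : ℂ) (n : ℕ) : ℂ :=
  ∑ k ∈ Finset.range (n + 1), (c + k) * (uu q (c + 1 + k) (n - k) * uu d b k)

lemma TT_succ (q d c b : ℂ) (n : ℕ) :
    TT q d c b (n + 1) = c * SS q d (c + 1) b (n + 1) + d * b * SS q d (c + 1 + 1) (b + 1) n := by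
  have : TT q d c b (n + 1) = c * SS q d (c + 1) b (n + 1) +
      ∑ k ∈ Finset.range (n + 1 + 1), (k : ℂ) * (uu q (c + 1 + k) (n + 1 - k) * uu d b k) := by
    unfold TT SS
    rw [Finset.mul_sum, ← Finset.sum_add_distrib]
    exact Finset.sum_congr rfl fun k _ => by ring
  rw [this, Finset.sum_range_succ']
  unfold SS
  rw [Finset.mul_sum _ _ (d * b)]
  simp only [Nat.cast_zero, zero_mul, add_zero]
  congr 1
  refine Finset.sum_congr rfl fun k _ => ?_
  have h := uu_der d b k
  rw [Nat.add_sub_add_right]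
  push_cast
  rw [show c + 1 + ((k : ℂ) + 1) = c + 1 + 1 + k by ring]
  linear_combination (uu q (c + 1 + 1 + k) (n - k)) * h

lemma SS_R3 (q d c b : ℂ) (n : ℕ) :
    ((n : ℂ) + 1) * SS q d c b (n + 1) = d * b * SS q d (c + 1) (b + 1) n + q * TT q d c b n := by
  have h1 : ((n : ℂ) + 1) * SS q d c b (n + 1) =
      ∑ k ∈ Finset.range (n + 1 + 1), (k : ℂ) * (uu q (c + k) (n + 1 - k) * uu d b k) +
      ∑ k ∈ Finset.range (n + 1 + 1), ((n : ℂ) + 1 - k) * (uu q (c + k) (n + 1 - k) * uu d b k) := by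
    unfold SS
    rw [Finset.mul_sum, ← Finset.sum_add_distrib]
    exact Finset.sum_congr rfl fun k _ => by ring
  rw [h1, Finset.sum_range_succ', Finset.sum_range_succ _ (n + 1)]
  unfold SS TT
  rw [Finset.mul_sum, Finset.mul_sum]
  simp only [Nat.cast_zero, zero_mul, add_zero]
  push_cast
  rw [sub_self, zero_mul, add_zero]
  congr 1
  · refine Finset.sum_congr rfl fun k _ => ?_
    have h := uu_der d b k
    rw [show c + ((k : ℂ) + 1) = c + 1 + k by ring]
    linear_combination (uu q (c + 1 + k) (n - k)) * h
  · refine Finset.sum_congr rfl fun k hk => ?_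
    have hk' : k ≤ n := by simpa [Nat.lt_succ_iff] using hk
    have h := uu_der q (c + k) (n - k)
    rw [Nat.sub_add_comm hk']
    rw [Nat.cast_sub hk', show c + (k : ℂ) + 1 = c + 1 + k by ring] at h
    linear_combination (uu d b k) * h

noncomputable def SZ (q d c b : ℂ) (n : ℤ) : ℂ := if n < 0 then 0 else SS q d c b n.toNat

lemma SZ_nat (q d c b : ℂ) (n : ℕ) : SZ q d c b n = SS q d c b n := by simp [SZ]

lemma SZ_neg (q d c b : ℂ) (n : ℤ) (h : n < 0) : SZ q d c b n = 0 := by simp [SZ, h]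

lemma int_cases (n : ℤ) : n < 0 ∨ n = 0 ∨ ∃ m : ℕ, n = m + 1 := by
  rcases lt_trichotomy n 0 with h | h | h
  · exact Or.inl h
  · exact Or.inr (Or.inl h)
  · exact Or.inr (Or.inr ⟨(n - 1).toNat, by omega⟩)

lemma SZ_zero (q d c b : ℂ) : SZ q d c b 0 = 1 := by simp [SZ, SS_zero]

lemma SZ_succ (q d c b : ℂ) (n : ℕ) : SZ q d c b ((n : ℤ) + 1) = SS q d c b (n + 1) := by
  exact_mod_cast SZ_nat q d c b (n + 1)

lemma SZ_R1 (q d c b : ℂ) (n : ℤ) :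
    SZ q d c b n = SZ q d (c + 1) b n - q * SZ q d (c + 1) b (n - 1) := by
  rcases int_cases n with h | rfl | ⟨m, rfl⟩
  · rw [SZ_neg _ _ _ _ _ h, SZ_neg _ _ _ _ _ h, SZ_neg _ _ _ _ (n - 1) (by omega)]; ring
  · rw [SZ_zero, SZ_zero, SZ_neg _ _ _ _ _ (by omega)]; ring
  · rw [SZ_succ, SZ_succ, add_sub_cancel_right, SZ_nat, SS_R1]

lemma SZ_R2 (q d c b : ℂ) (n : ℤ) :
    SZ q d c (b + 1) n - SZ q d c b n = d * SZ q d (c + 1) (b + 1) (n - 1) := by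
  rcases int_cases n with h | rfl | ⟨m, rfl⟩
  · rw [SZ_neg _ _ _ _ _ h, SZ_neg _ _ _ _ _ h, SZ_neg _ _ _ _ (n - 1) (by omega)]; ring
  · rw [SZ_zero, SZ_zero, SZ_neg _ _ _ _ _ (by omega)]; ring
  · rw [SZ_succ, SZ_succ, add_sub_cancel_right, SZ_nat, SS_R2]

lemma SZ_R3 (q d c b : ℂ) (n : ℤ) :
    (n : ℂ) * SZ q d c b n = d * b * SZ q d (c + 1) (b + 1) (n - 1)
      + q * (c * SZ q d (c + 1) b (n - 1) + d * b * SZ q d (c + 1 + 1) (b + 1) (n - 2)) := by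
  rcases int_cases n with h | rfl | ⟨m, rfl⟩
  · rw [SZ_neg _ _ _ _ _ h, SZ_neg _ _ _ _ (n - 1) (by omega), SZ_neg _ _ _ _ (n - 1) (by omega),
      SZ_neg _ _ _ _ (n - 2) (by omega)]; ring
  · rw [SZ_neg _ _ _ _ (0 - 1) (by omega), SZ_neg _ _ _ _ (0 - 1) (by omega),
      SZ_neg _ _ _ _ (0 - 2) (by omega)]; simp
  · rw [SZ_succ, add_sub_cancel_right, SZ_nat, SZ_nat]
    push_cast
    rw [SS_R3]
    congr 2
    cases m with
    | zero =>
      rw [SZ_neg _ _ _ _ _ (by simp), SS_zero]; simp [TT, uu_zero]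
    | succ m =>
      rw [TT_succ, show ((m + 1 : ℕ) : ℤ) + 1 - 2 = m by push_cast; ring, SZ_nat]

/-- three term recurrence -/
lemma SZ_rec (q p c b : ℂ) (hqp : q * p = 1) (n : ℤ) :
    (n : ℂ) * SZ q (p - q) c b n =
      (((n : ℂ) - 1) * (q + p) - q * (b - c) + p * b) * SZ q (p - q) c b (n - 1)
        - ((n : ℂ) - 2 + c) * SZ q (p - q) c b (n - 2) := by
  have key : ∀ m : ℤ, SZ q (p - q) (c + 1) (b + 1) m =
      SZ q (p - q) (c + 1 + 1) (b + 1) m - q * SZ q (p - q) (c + 1 + 1) (b + 1) (m - 1) :=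
    fun m => SZ_R1 _ _ _ _ m
  have key2 : ∀ m : ℤ, SZ q (p - q) (c + 1) b m =
      SZ q (p - q) (c + 1 + 1) (b + 1) m - p * SZ q (p - q) (c + 1 + 1) (b + 1) (m - 1) := by
    intro m
    linear_combination key m - SZ_R2 q (p - q) (c + 1) b m
  have key3 : ∀ m : ℤ, SZ q (p - q) c b m = SZ q (p - q) (c + 1 + 1) (b + 1) m
      - (q + p) * SZ q (p - q) (c + 1 + 1) (b + 1) (m - 1)
      + SZ q (p - q) (c + 1 + 1) (b + 1) (m - 2) := by
    intro m
    have h := key2 (m - 1)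
    rw [show m - 1 - 1 = m - 2 by ring] at h
    linear_combination SZ_R1 q (p - q) c b m + key2 m - q * h +
      SZ q (p - q) (c + 1 + 1) (b + 1) (m - 2) * hqp
  have D : ∀ m : ℤ, (m : ℂ) * SZ q (p - q) c b m =
      ((p - q) * b + q * c) * SZ q (p - q) (c + 1 + 1) (b + 1) (m - 1)
      - c * SZ q (p - q) (c + 1 + 1) (b + 1) (m - 2) := by
    intro m
    have h1 := key (m - 1)
    have h2 := key2 (m - 1)
    rw [show m - 1 - 1 = m - 2 by ring] at h1 h2
    linear_combination SZ_R3 q (p - q) c b m + (p - q) * b * h1 + q * c * h2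
      - c * SZ q (p - q) (c + 1 + 1) (b + 1) (m - 2) * hqp
  have D0 := D n
  have D1 := D (n - 1)
  have D2 := D (n - 2)
  have K1 := key3 (n - 1)
  have K2 := key3 (n - 2)
  rw [show n - 1 - 1 = n - 2 by ring, show n - 1 - 2 = n - 3 by ring] at D1 K1
  rw [show n - 2 - 1 = n - 3 by ring, show n - 2 - 2 = n - 4 by ring] at D2 K2
  push_cast at D1 D2
  linear_combination D0 - (q + p) * D1 + D2 + (q * (b - c) - p * b) * K1 + c * K2

lemma SZ_shiftA (q p c b : ℂ) (n : ℤ) : SZ q (p - q) c (b + 1) n =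
      SZ q (p - q) (c + 1) (b + 1) n - q * SZ q (p - q) (c + 1) (b + 1) (n - 1) :=
  SZ_R1 _ _ _ _ n

lemma SZ_shiftB (q p c b : ℂ) (n : ℤ) : SZ q (p - q) c b n =
      SZ q (p - q) (c + 1) (b + 1) n - p * SZ q (p - q) (c + 1) (b + 1) (n - 1) := by
  linear_combination SZ_R1 q (p - q) c (b + 1) n - SZ_R2 q (p - q) c b n

lemma poch_ne (a : ℝ) (ha : 0 < a) (k : ℕ) : poch (2 * (a : ℂ)) k ≠ 0 := by
  induction k with
  | zero => simp [poch_zero]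
  | succ k ih =>
    rw [poch_succ]
    refine mul_ne_zero ih ?_
    have : (0 : ℝ) < 2 * a + k := by positivity
    exact_mod_cast this.ne'

lemma MP_eq (a φ : ℝ) (ha : 0 < a) (n : ℕ) (x q p : ℂ) (hq : q = Complex.exp (φ * Complex.I))
    (hp : p = Complex.exp (-(φ * Complex.I))) (hqp : q * p = 1) :
    MP a φ n x = SZ q (p - q) (2 * a) (a + Complex.I * x) n := by
  rw [SZ_nat]
  unfold MP SS
  have e1 : Complex.exp ((n : ℂ) * (φ : ℂ) * Complex.I) = q ^ n := by
    rw [hq, ← Complex.exp_nat_mul]; ring_nf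
  have e2 : Complex.exp (-(2 * (φ : ℂ) * Complex.I)) = p ^ 2 := by
    rw [hp, ← Complex.exp_nat_mul]; push_cast; ring_nf
  rw [e1, e2, Finset.mul_sum]
  refine Finset.sum_congr rfl fun k hk => ?_
  have hk' : k ≤ n := by simpa [Nat.lt_succ_iff] using hk
  obtain ⟨m, rfl⟩ := Nat.exists_eq_add_of_le hk'
  rw [Nat.add_sub_cancel_left]
  unfold uu
  have h1 : (m.factorial : ℂ) ≠ 0 := by exact_mod_cast m.factorial_ne_zero
  have h2 : (k.factorial : ℂ) ≠ 0 := by exact_mod_cast k.factorial_ne_zero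
  have h3 : ((k + m).factorial : ℂ) ≠ 0 := by exact_mod_cast (k + m).factorial_ne_zero
  have h4 := poch_ne a ha k
  have e3 : poch (-((k + m : ℕ) : ℂ)) k = (-1) ^ k * ((k + m).factorial : ℂ) / m.factorial := by
    rw [eq_div_iff h1, poch_neg]
  have e4 : (p - q) ^ k = (-1) ^ k * q ^ k * (1 - p ^ 2) ^ k := by
    rw [← mul_pow, ← mul_pow]
    congr 1
    linear_combination (-p) * hqp
  rw [e3, e4, poch_add, pow_add]
  field_simp

lemma xi_eq (a φ : ℝ) (ha : a ≠ 1) (x q p : ℂ) (hq : q = Complex.exp (φ * Complex.I))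
    (hp : p = Complex.exp (-(φ * Complex.I))) (hqp : q * p = 1) :
    MP (1 - a) φ 1 x = (1 - a) * (q + p) - Complex.I * x * (q - p) := by
  have e2 : Complex.exp (-(2 * (φ : ℂ) * Complex.I)) = p ^ 2 := by
    rw [hp, ← Complex.exp_nat_mul]; push_cast; ring_nf
  have h : (1 - (a : ℂ)) ≠ 0 := by
    intro h; apply ha
    have : (a : ℂ) = 1 := by linear_combination -h
    exact_mod_cast this
  unfold MP
  rw [e2]
  simp [Finset.sum_range_succ, poch_succ, poch_zero]
  rw [← hq]
  field_simp
  linear_combination ((1 - a + Complex.I * x) * p) * hqp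

/-- the linear form of the deformed polynomial -/
noncomputable def WW (a z q p h1 h0 : ℂ) : ℂ :=
  (-((1 - a) * (q + p) - (z - 1 / 2) * (q - p)) * (a - 1 / 2 + z)) * (h1 - q * h0)
    - ((1 - a) * (q + p) - (z + 1 / 2) * (q - p)) * (a - 1 / 2 - z) * (h1 - p * h0)

lemma elim_aux (A n X c r e0 e1 L1 L0 M1 M2 h2 h1 h0 g1 g2 g3 : ℂ)
    (R2 : (n + 2) * h2 = L1 * h1 - (A + 1) * h0)
    (R1 : (n + 1) * h1 = L0 * h0 - A * g1)
    (R0 : (A - 1) * g2 = M1 * g1 - n * h0)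
    (R3 : (A - 2) * g3 = M2 * g2 - (n - 1) * g1)
    (K0 : A * X * e0 = (A - 2) / 4 * ((e0 * L1 + (n + 2) * e1) * L0 - (n + 1) * (A + 1) * e0)
      - A * (A - 2) * c * (e0 * L0 + (n + 1) * e1) + A * r * e0 + A * (A - 2) * c * e1 * n
      - A / 4 * ((A - 2) * e0 + e1 * M2) * n)
    (K1 : A * X * e1 = -(A - 2) / 4 * (e0 * L1 + (n + 2) * e1) * A + A ^ 2 * (A - 2) * c * e0
      + A * r * e1 - A * (A - 2) * c * ((A - 1) * e0 + e1 * M1)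
      + A / 4 * (((A - 2) * e0 + e1 * M2) * M1 - (A - 1) * (n - 1) * e1)) :
    A * (X * (e0 * h0 + e1 * g1)) =
      (n + 1) * (n + 2) * (A - 2) / 4 * (e0 * h2 + e1 * h1)
      + A * (-(n + 1) * (A - 2) * c * (e0 * h1 + e1 * h0) + r * (e0 * h0 + e1 * g1)
      + (-(A - 2) * (A - 1) * c) * (e0 * g1 + e1 * g2)
      + ((A - 2) * (A - 1) / 4) * (e0 * g2 + e1 * g3)) := by
  linear_combination h0 * K0 + g1 * K1 - ((n + 1) * (A - 2) / 4 * e0) * R2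
    - ((A - 2) / 4 * (e0 * L1 + (n + 2) * e1) - A * (A - 2) * c * e0) * R1
    - A * (A - 1) / 4 * e1 * R3
    - (A / 4 * ((A - 2) * e0 + e1 * M2) - A * (A - 2) * c * e1) * R0

lemma WW_rec (a z q n h2 h1 h0 g1 g2 g3 : ℂ) (hq : q ≠ 0)
    (r2 : (n + 2) * h2 = ((n + 1) * (q + q⁻¹) - q * (z - a - 1 / 2) + q⁻¹ * (a + z + 1 / 2)) * h1
      - (n + 2 * a + 1) * h0)
    (r1 : (n + 1) * h1 = (n * (q + q⁻¹) - q * (z - a - 1 / 2) + q⁻¹ * (a + z + 1 / 2)) * h0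
      - (n + 2 * a) * g1)
    (r0 : n * h0 = ((n - 1) * (q + q⁻¹) - q * (z - a - 1 / 2) + q⁻¹ * (a + z + 1 / 2)) * g1
      - (n + 2 * a - 1) * g2)
    (r3 : (n - 1) * g1 = ((n - 2) * (q + q⁻¹) - q * (z - a - 1 / 2) + q⁻¹ * (a + z + 1 / 2)) * g2
      - (n + 2 * a - 2) * g3) :
    (2 * a + n) * ((-(q - q⁻¹) * z / 2) * (-(q - q⁻¹) * z / 2 + (1 - a) * (q + q⁻¹))
        * WW a z q q⁻¹ h0 g1) =
      (n + 1) * (n + 2) * (2 * a + n - 2) / 4 * WW a z q q⁻¹ h2 h1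
      + (2 * a + n) * (-(n + 1) * (2 * a + n - 2) * ((q + q⁻¹) / 2) * WW a z q q⁻¹ h1 h0
      + ((a * (6 * a + 10 * n - 7) + 3 * n ^ 2 - 7 * n + 1) / 2
          + (1 / 4) * (2 * a + 2 * n - 1) * (6 * a + 2 * n - 5) * ((q - q⁻¹) ^ 2 / 4))
          * WW a z q q⁻¹ h0 g1
      + (-(2 * a + n - 2) * (2 * a + n - 1) * ((q + q⁻¹) / 2)) * WW a z q q⁻¹ g1 g2
      + ((2 * a + n - 2) * (2 * a + n - 1) / 4) * WW a z q q⁻¹ g2 g3) := by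
  have hW : ∀ s t, WW a z q q⁻¹ s t =
    (-((1 - a) * (q + q⁻¹) - (z - 1 / 2) * (q - q⁻¹)) * (a - 1 / 2 + z)
    - ((1 - a) * (q + q⁻¹) - (z + 1 / 2) * (q - q⁻¹)) * (a - 1 / 2 - z)) * s +
    (((1 - a) * (q + q⁻¹) - (z - 1 / 2) * (q - q⁻¹)) * (a - 1 / 2 + z) * q
    + ((1 - a) * (q + q⁻¹) - (z + 1 / 2) * (q - q⁻¹)) * (a - 1 / 2 - z) * q⁻¹) * t := by
    intro s t; simp only [WW]; ring
  simp only [hW]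
  refine elim_aux (2 * a + n) n _ _ _ _ _
    ((n + 1) * (q + q⁻¹) - q * (z - a - 1 / 2) + q⁻¹ * (a + z + 1 / 2))
    (n * (q + q⁻¹) - q * (z - a - 1 / 2) + q⁻¹ * (a + z + 1 / 2))
    ((n - 1) * (q + q⁻¹) - q * (z - a - 1 / 2) + q⁻¹ * (a + z + 1 / 2))
    ((n - 2) * (q + q⁻¹) - q * (z - a - 1 / 2) + q⁻¹ * (a + z + 1 / 2))
    _ _ _ _ _ _ ?_ ?_ ?_ ?_ ?_ ?_
  · linear_combination r2
  · linear_combination r1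
  · linear_combination r0
  · linear_combination r3
  · field_simp
    ring
  · field_simp
    ring

lemma PD1_eq (a φ : ℝ) (ha : 0 < a) (ha1 : a ≠ 1) (n : ℕ) (x q p : ℂ)
    (hq : q = Complex.exp (φ * Complex.I))
    (hp : p = Complex.exp (-(φ * Complex.I))) (hqp : q * p = 1) :
    PD1 a φ n x = Complex.I * WW a (Complex.I * x) q p
      (SZ q (p - q) (2 * a + 1) (a + Complex.I * x - 1 / 2 + 1) n)
      (SZ q (p - q) (2 * a + 1) (a + Complex.I * x - 1 / 2 + 1) ((n : ℤ) - 1)) := by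
  unfold PD1 WW
  rw [xi_eq a φ ha1 _ q p hq hp hqp, xi_eq a φ ha1 _ q p hq hp hqp,
    MP_eq a φ ha n _ q p hq hp hqp, MP_eq a φ ha n _ q p hq hp hqp]
  have i2 := Complex.I_sq
  rw [show (a : ℂ) + Complex.I * (x - Complex.I / 2) = a + Complex.I * x - 1 / 2 + 1 by
      linear_combination (-1 / 2) * i2,
    show (a : ℂ) + Complex.I * (x + Complex.I / 2) = a + Complex.I * x - 1 / 2 by
      linear_combination (1 / 2) * i2,
    SZ_shiftA q p (2 * a) (a + Complex.I * x - 1 / 2) n,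
    SZ_shiftB q p (2 * a) (a + Complex.I * x - 1 / 2) n,
    show Complex.I * (x + Complex.I / 2) = Complex.I * x - 1 / 2 by
      linear_combination (1 / 2) * i2,
    show Complex.I * (x - Complex.I / 2) = Complex.I * x + 1 / 2 by
      linear_combination (-1 / 2) * i2]
  ring

/-- The 5-term recurrence with constant coefficients for the multi-indexed
Meixner-Pollaczek polynomials with `D = {1}`, `X(η) = η(sin φ·η + 2(1-a) cos φ)`. -/
theorem PD1_five_term_recurrence (a φ : ℝ) (ha : 0 < a) (hφ1 : 0 < φ) (hφ2 : φ < Real.pi)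
    (n : ℕ) (x : ℂ) :
    x * ((Real.sin φ : ℂ) * x + 2 * (1 - (a : ℂ)) * (Real.cos φ : ℂ)) * PD1 a φ n x =
      (((n : ℂ) + 1) * ((n : ℂ) + 2) / (4 * (Real.sin φ : ℂ)) *
          ((2 * (a : ℂ) + n - 2) / (2 * (a : ℂ) + n))) * PD1 a φ (n + 2) x
      + (-((n : ℂ) + 1) * (2 * (a : ℂ) + n - 2) * ((Real.cos φ : ℂ) / (Real.sin φ : ℂ))) *
          PD1 a φ (n + 1) x
      + (((a : ℂ) * (6 * (a : ℂ) + 10 * n - 7) + 3 * (n : ℂ) ^ 2 - 7 * n + 1) /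
            (2 * (Real.sin φ : ℂ))
          - (1 / 4) * (2 * (a : ℂ) + 2 * n - 1) * (6 * (a : ℂ) + 2 * n - 5) *
            (Real.sin φ : ℂ)) * PD1 a φ n x
      + (-(2 * (a : ℂ) + n - 2) * (2 * (a : ℂ) + n - 1) *
            ((Real.cos φ : ℂ) / (Real.sin φ : ℂ))) *
          (if 1 ≤ n then PD1 a φ (n - 1) x else 0)
      + ((2 * (a : ℂ) + n - 2) * (2 * (a : ℂ) + n - 1) / (4 * (Real.sin φ : ℂ))) *
          (if 2 ≤ n then PD1 a φ (n - 2) x else 0) := by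
  by_cases ha1 : a = 1
  · have h0 : ∀ y, MP (1 - a) φ 1 y = 0 := by
      intro y; simp [MP, ha1, poch_succ, poch_zero]
    have hP : ∀ m, PD1 a φ m x = 0 := by
      intro m; simp [PD1, h0]
    simp [hP]
  obtain ⟨q, hq⟩ : ∃ q, q = Complex.exp (φ * Complex.I) := ⟨_, rfl⟩
  have hq0 : q ≠ 0 := by rw [hq]; exact Complex.exp_ne_zero _
  have hp : q⁻¹ = Complex.exp (-(φ * Complex.I)) := by rw [hq, Complex.exp_neg]
  have hqp : q * q⁻¹ = 1 := mul_inv_cancel₀ hq0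
  have i2 := Complex.I_sq
  have hs : (Real.sin φ : ℂ) = -Complex.I * (q - q⁻¹) / 2 := by
    rw [hp, hq, Complex.ofReal_sin, Complex.sin]; ring_nf
  have hc : (Real.cos φ : ℂ) = (q + q⁻¹) / 2 := by
    rw [hp, hq, Complex.ofReal_cos, Complex.cos]; ring_nf
  have hs0 : (Real.sin φ : ℂ) ≠ 0 := by
    exact_mod_cast (Real.sin_pos_of_pos_of_lt_pi hφ1 hφ2).ne'
  have hA : 2 * (a : ℂ) + n ≠ 0 := by
    have : (0 : ℝ) < 2 * a + n := by positivity
    exact_mod_cast this.ne'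
  obtain ⟨H, hH⟩ : ∃ H : ℤ → ℂ,
    H = SZ q (q⁻¹ - q) (2 * a + 1) (a + Complex.I * x - 1 / 2 + 1) := ⟨_, rfl⟩
  have hPD : ∀ m : ℕ, PD1 a φ m x =
      Complex.I * WW a (Complex.I * x) q q⁻¹ (H m) (H ((m : ℤ) - 1)) := by
    intro m; rw [hH]; exact PD1_eq a φ ha ha1 m x q q⁻¹ hq hp hqp
  have hneg : ∀ m : ℤ, m < 0 → H m = 0 := by
    intro m hm; rw [hH]; exact SZ_neg _ _ _ _ _ hm
  have hrec : ∀ m : ℤ, (m : ℂ) * H m = (((m : ℂ) - 1) * (q + q⁻¹)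
      - q * (a + Complex.I * x - 1 / 2 + 1 - (2 * a + 1)) + q⁻¹ * (a + Complex.I * x - 1 / 2 + 1))
        * H (m - 1) - ((m : ℂ) - 2 + (2 * a + 1)) * H (m - 2) := by
    intro m; rw [hH]; exact SZ_rec _ _ _ _ hqp m
  have e1 : (if 1 ≤ n then PD1 a φ (n - 1) x else 0) =
      Complex.I * WW a (Complex.I * x) q q⁻¹ (H ((n : ℤ) - 1)) (H ((n : ℤ) - 2)) := by
    split_ifs with h
    · rw [hPD, Nat.cast_sub h]
      push_cast
      rw [show (n : ℤ) - 1 - 1 = n - 2 by ring]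
    · rw [hneg _ (by omega), hneg _ (by omega)]; simp [WW]
  have e2 : (if 2 ≤ n then PD1 a φ (n - 2) x else 0) =
      Complex.I * WW a (Complex.I * x) q q⁻¹ (H ((n : ℤ) - 2)) (H ((n : ℤ) - 3)) := by
    split_ifs with h
    · rw [hPD, Nat.cast_sub h]
      push_cast
      rw [show (n : ℤ) - 2 - 1 = n - 3 by ring]
    · rw [hneg _ (by omega), hneg _ (by omega)]; simp [WW]
  have r2 := hrec ((n : ℤ) + 2)
  have r1 := hrec ((n : ℤ) + 1)
  have r0 := hrec (n : ℤ)
  have r3 := hrec ((n : ℤ) - 1)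
  rw [show (n : ℤ) + 2 - 1 = n + 1 by ring, show (n : ℤ) + 2 - 2 = n by ring] at r2
  rw [show (n : ℤ) + 1 - 1 = n by ring, show (n : ℤ) + 1 - 2 = n - 1 by ring] at r1
  rw [show (n : ℤ) - 1 - 1 = n - 2 by ring, show (n : ℤ) - 1 - 2 = n - 3 by ring] at r3
  push_cast at r2 r1 r0 r3
  have main := WW_rec a (Complex.I * x) q n (H (n + 2)) (H (n + 1)) (H n) (H (n - 1)) (H (n - 2))
    (H (n - 3)) hq0 (by linear_combination r2) (by linear_combination r1)
    (by linear_combination r0) (by linear_combination r3)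
  rw [e1, e2, hPD, hPD, hPD]
  simp only [Nat.cast_add, Nat.cast_ofNat, Nat.cast_one]
  rw [show (n : ℤ) + 2 - 1 = n + 1 by ring, show (n : ℤ) + 1 - 1 = n by ring]
  generalize WW (a : ℂ) (Complex.I * x) q q⁻¹ (H (n + 2)) (H (n + 1)) = w2 at *
  generalize WW (a : ℂ) (Complex.I * x) q q⁻¹ (H (n + 1)) (H n) = w1 at *
  generalize WW (a : ℂ) (Complex.I * x) q q⁻¹ (H n) (H (n - 1)) = w0 at *
  generalize WW (a : ℂ) (Complex.I * x) q q⁻¹ (H (n - 1)) (H (n - 2)) = v1 at *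
  generalize WW (a : ℂ) (Complex.I * x) q q⁻¹ (H (n - 2)) (H (n - 3)) = v2 at *
  have f1 : -(q - q⁻¹) * (Complex.I * x) / 2 = (Real.sin φ : ℂ) * x := by rw [hs]; ring
  have f2 : (q - q⁻¹) ^ 2 / 4 = -(Real.sin φ : ℂ) ^ 2 := by
    rw [hs]; linear_combination ((q - q⁻¹) ^ 2 / 4) * i2
  have f3 : q + q⁻¹ = 2 * (Real.cos φ : ℂ) := by rw [hc]; ring
  rw [f1, f2, f3] at main
  clear hs hc
  generalize (Real.sin φ : ℂ) = s at *
  generalize (Real.cos φ : ℂ) = c at *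
  field_simp
  linear_combination 8 * main
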